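/- For all indices i, k with 1 ≤ i, k ≤ L−1 and every (t,α) ∈ ℝ × ℝ^{L−1}, the curvature coefficient R^k_{0i0}(t,α) equals ( p_i'(t) p_k(t) B(t)² P(t) − p_i'(t) p_k'(t) B(t) (N(t) B(t) + A(t,α)²) ) / (N(t) B(t) + A(t,α)²)², where P(t) = Σ_{m=1}^{L−1} p_m(t) p_m'(t). -/

import Mathlib

/-!
Formalization of results from "A geometric approach to equilibrium selection":
the metric, Christoffel symbols and curvature of the equilibrium manifold of a
two-consumer exchange economy with `L` goods, parametrized by
`Φ(t,α) = (p_1(t),…,p_{L−1}(t), α_1,…,α_{L−1}, w(t) − Σ_m p_m(t) α_m)`.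

Indices run over `Fin L`, where the index `0` corresponds to the coordinate
`x_0 = t` and an index `i ≠ 0` corresponds to the coordinate `x_i = α_i`
(the component `α 0` of `α : Fin L → ℝ` is never used, so `α` is just a copy
of `ℝ^{L−1}` together with an irrelevant extra coordinate).
-/

open Matrix BigOperators

noncomputable section

namespace EqSelection

variable {L : ℕ}

/-- `A(t,α) = w'(t) − Σ_{m=1}^{L−1} p_m'(t) α_m`. -/
def eqA [NeZero L] (p : Fin L → ℝ → ℝ) (w : ℝ → ℝ) (t : ℝ) (α : Fin L → ℝ) : ℝ :=
  deriv w t - ∑ m ∈ Finset.univ \ {0}, deriv (p m) t * α m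

/-- `A'(t,α) = w''(t) − Σ_{m=1}^{L−1} p_m''(t) α_m`. -/
def eqA' [NeZero L] (p : Fin L → ℝ → ℝ) (w : ℝ → ℝ) (t : ℝ) (α : Fin L → ℝ) : ℝ :=
  deriv (deriv w) t - ∑ m ∈ Finset.univ \ {0}, deriv (deriv (p m)) t * α m

/-- `B(t) = Σ_{m=1}^{L−1} (p_m'(t))²`. -/
def eqB [NeZero L] (p : Fin L → ℝ → ℝ) (t : ℝ) : ℝ :=
  ∑ m ∈ Finset.univ \ {0}, (deriv (p m) t) ^ 2

/-- `N(t) = 1 + Σ_{m=1}^{L−1} (p_m(t))²`. -/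
def eqN [NeZero L] (p : Fin L → ℝ → ℝ) (t : ℝ) : ℝ :=
  1 + ∑ m ∈ Finset.univ \ {0}, (p m t) ^ 2

/-- `C(t) = Σ_{m=1}^{L−1} p_m'(t) p_m''(t)`. -/
def eqC [NeZero L] (p : Fin L → ℝ → ℝ) (t : ℝ) : ℝ :=
  ∑ m ∈ Finset.univ \ {0}, deriv (p m) t * deriv (deriv (p m)) t

/-- `P(t) = Σ_{m=1}^{L−1} p_m(t) p_m'(t)`. -/
def eqP [NeZero L] (p : Fin L → ℝ → ℝ) (t : ℝ) : ℝ :=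
  ∑ m ∈ Finset.univ \ {0}, p m t * deriv (p m) t

/-- The induced metric matrix `g(t,α)`: `g_{00} = B + A²`, `g_{0i} = g_{i0} = −p_i A`,
`g_{ij} = p_i p_j + δ_{ij}` for `i, j ≠ 0`. -/
def gMat [NeZero L] (p : Fin L → ℝ → ℝ) (w : ℝ → ℝ) (t : ℝ) (α : Fin L → ℝ) :
    Matrix (Fin L) (Fin L) ℝ :=
  Matrix.of fun i j =>
    if i = 0 then
      if j = 0 then eqB p t + (eqA p w t α) ^ 2 else -(p j t) * eqA p w t α
    else
      if j = 0 then -(p i t) * eqA p w t α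
      else p i t * p j t + (if i = j then 1 else 0)

/-- Partial derivative with respect to the coordinate `x_k`, where `x_0 = t`
and `x_i = α_i` for `i ≠ 0`. -/
def pder [NeZero L] (k : Fin L) (f : ℝ → (Fin L → ℝ) → ℝ) (t : ℝ) (α : Fin L → ℝ) : ℝ :=
  if k = 0 then deriv (fun s => f s α) t
  else deriv (fun s => f t (Function.update α k s)) (α k)

/-- Christoffel symbol
`Γ^k_{ij} = (1/2) Σ_{h=0}^{L−1} g^{hk} (∂g_{jh}/∂x_i + ∂g_{hi}/∂x_j − ∂g_{ij}/∂x_h)`,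
written `christoffel p w i j k`.  (Here `g^{hk}` denotes the entries of the inverse
matrix of `g`, i.e. of `(gMat p w t α)⁻¹`.) -/
def christoffel [NeZero L] (p : Fin L → ℝ → ℝ) (w : ℝ → ℝ) (i j k : Fin L)
    (t : ℝ) (α : Fin L → ℝ) : ℝ :=
  (1 / 2) * ∑ h : Fin L,
    (gMat p w t α)⁻¹ h k *
      (pder i (fun t' α' => gMat p w t' α' j h) t α
        + pder j (fun t' α' => gMat p w t' α' h i) t α
        - pder h (fun t' α' => gMat p w t' α' i j) t α)

/-- Curvature coefficient
`R^s_{ijk} = Σ_{m} Γ^m_{ik} Γ^s_{jm} − Σ_{m} Γ^m_{jk} Γ^s_{im} + ∂Γ^s_{ik}/∂x_j − ∂Γ^s_{jk}/∂x_i`,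
written `curvR p w i j k s`. -/
def curvR [NeZero L] (p : Fin L → ℝ → ℝ) (w : ℝ → ℝ) (i j k s : Fin L)
    (t : ℝ) (α : Fin L → ℝ) : ℝ :=
  (∑ m : Fin L, christoffel p w i k m t α * christoffel p w j m s t α)
    - (∑ m : Fin L, christoffel p w j k m t α * christoffel p w i m s t α)
    + pder j (christoffel p w i k s) t α - pder i (christoffel p w j k s) t α

/-- The coordinate tangent vectors `Φ_i(t,α) ∈ ℝ^{2L−1}` of the parametrization
`Φ(t,α) = (p_1(t),…,p_{L−1}(t), α_1,…,α_{L−1}, w(t) − Σ_m p_m(t) α_m)`: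
`Φ_0 = (p_1',…,p_{L−1}', 0,…,0, A)`, and for `i ≠ 0` the vector `Φ_i` has entry `1`
in position `(L−1)+i` (1-indexed), entry `−p_i` in the last position and `0` elsewhere. -/
def PhiVec [NeZero L] (p : Fin L → ℝ → ℝ) (w : ℝ → ℝ) (i : Fin L)
    (t : ℝ) (α : Fin L → ℝ) : Fin (2 * L - 1) → ℝ :=
  fun j =>
    if i = 0 then
      if h : (j : ℕ) < L - 1 then deriv (p ⟨(j : ℕ) + 1, by omega⟩) t
      else if (j : ℕ) = 2 * L - 2 then eqA p w t α else 0
    else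
      if (j : ℕ) + 1 = (L - 1) + (i : ℕ) then 1
      else if (j : ℕ) = 2 * L - 2 then -(p i t) else 0

/-- The matrix `M(t,α)` of Statement 2: `M_{00} = N`, `M_{0i} = M_{i0} = p_i A`,
`M_{ii} = (N − p_i²) B + A²`, `M_{ij} = −p_i p_j B` for `i ≠ j`, `i, j ≠ 0`. -/
def invNumer [NeZero L] (p : Fin L → ℝ → ℝ) (w : ℝ → ℝ) (t : ℝ) (α : Fin L → ℝ) :
    Matrix (Fin L) (Fin L) ℝ :=
  Matrix.of fun i j =>
    if i = 0 then
      if j = 0 then eqN p t else p j t * eqA p w t α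
    else
      if j = 0 then p i t * eqA p w t α
      else if i = j then (eqN p t - (p i t) ^ 2) * eqB p t + (eqA p w t α) ^ 2
      else -(p i t * p j t * eqB p t)

section Curvature

variable [NeZero L] {p : Fin L → ℝ → ℝ} {w : ℝ → ℝ}

lemma sum_univ_eq_zero_add (f : Fin L → ℝ) :
    ∑ h, f h = f 0 + ∑ h ∈ Finset.univ \ {0}, f h := by
  rw [← Finset.sum_sdiff (Finset.subset_univ {0}), Finset.sum_singleton, add_comm]

lemma eqB_nonneg (p : Fin L → ℝ → ℝ) (t : ℝ) : 0 ≤ eqB p t :=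
  Finset.sum_nonneg fun _ _ => sq_nonneg _

lemma eqN_pos (p : Fin L → ℝ → ℝ) (t : ℝ) : 0 < eqN p t :=
  add_pos_of_pos_of_nonneg one_pos (Finset.sum_nonneg fun _ _ => sq_nonneg _)

/-- The determinant `N B + A²` of the metric is positive. -/
lemma eqN_mul_eqB_add_sq_pos {t : ℝ} (hreg : 0 < eqB p t ∨ deriv w t ≠ 0) (α : Fin L → ℝ) :
    0 < eqN p t * eqB p t + eqA p w t α ^ 2 := by
  rcases (eqB_nonneg p t).lt_or_eq with hB | hB
  · exact add_pos_of_pos_of_nonneg (mul_pos (eqN_pos p t) hB) (sq_nonneg _)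
  · have hw' : deriv w t ≠ 0 := hreg.resolve_left hB.ge.not_gt
    have hp' : ∀ m ∈ Finset.univ \ {0}, deriv (p m) t ^ 2 = 0 :=
      (Finset.sum_eq_zero_iff_of_nonneg fun _ _ => sq_nonneg _).1 hB.symm
    have hA : eqA p w t α = deriv w t := by
      rw [eqA, Finset.sum_eq_zero, sub_zero]
      intro m hm
      rw [pow_eq_zero_iff two_ne_zero |>.1 (hp' m hm), zero_mul]
    rw [hA, ← hB, mul_zero, zero_add]
    positivity

lemma gMat_comm (t : ℝ) (α : Fin L → ℝ) (i j : Fin L) :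
    gMat p w t α i j = gMat p w t α j i := by
  by_cases hi : i = 0 <;> by_cases hj : j = 0 <;>
    simp [gMat, hi, hj, mul_comm, eq_comm (a := i) (b := j)]

lemma christoffel_comm (i j k : Fin L) (t : ℝ) (α : Fin L → ℝ) :
    christoffel p w i j k t α = christoffel p w j i k t α := by
  simp only [christoffel, gMat_comm _ _ j, gMat_comm _ _ _ i]
  congr 1
  refine Finset.sum_congr rfl fun h _ => ?_
  ring

/-- The off-diagonal and diagonal entries of `invNumer` in a single formula. -/
lemma invNumer_apply_of_ne_zero {i j : Fin L} (hi : i ≠ 0) (hj : j ≠ 0) (t : ℝ) (α : Fin L → ℝ) :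
    invNumer p w t α i j =
      (if i = j then eqN p t * eqB p t + eqA p w t α ^ 2 else 0) - p i t * p j t * eqB p t := by
  simp only [invNumer, Matrix.of_apply, if_neg hi, if_neg hj]
  split_ifs with h
  · subst h; ring
  · ring

lemma gMat_mul_invNumer (t : ℝ) (α : Fin L → ℝ) :
    gMat p w t α * invNumer p w t α =
      (eqN p t * eqB p t + eqA p w t α ^ 2) • (1 : Matrix (Fin L) (Fin L) ℝ) := by
  have hN : ∑ h ∈ Finset.univ \ {0}, p h t ^ 2 = eqN p t - 1 := by rw [eqN]; ring
  ext i j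
  rw [Matrix.mul_apply, sum_univ_eq_zero_add, Matrix.smul_apply, Matrix.one_apply]
  by_cases hi : i = 0 <;> by_cases hj : j = 0
  · subst hi hj
    rw [Finset.sum_congr rfl (g := fun h => -eqA p w t α ^ 2 * p h t ^ 2)]
    · rw [← Finset.mul_sum, hN]
      simp [gMat, invNumer]
      ring
    · intro h hh
      have hh : h ≠ 0 := by simpa using hh
      simp [gMat, invNumer, hh]
      ring
  · subst hi
    rw [Finset.sum_congr rfl (g := fun h => p j t * eqA p w t α * eqB p t * p h t ^ 2 -
      if h = j then p j t * eqA p w t α * (eqN p t * eqB p t + eqA p w t α ^ 2) else 0)]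
    · rw [Finset.sum_sub_distrib, ← Finset.mul_sum, hN, Finset.sum_ite_eq']
      simp [gMat, invNumer, hj, Ne.symm hj]
      ring
    · intro h hh
      have hh : h ≠ 0 := by simpa using hh
      rw [invNumer_apply_of_ne_zero hh hj]
      simp only [gMat, Matrix.of_apply, if_neg hh, if_pos]
      split_ifs with e
      · subst e; ring
      · ring
  · subst hj
    rw [Finset.sum_congr rfl (g := fun h => p i t * eqA p w t α * p h t ^ 2 +
      if h = i then p i t * eqA p w t α else 0)]
    · rw [Finset.sum_add_distrib, ← Finset.mul_sum, hN, Finset.sum_ite_eq']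
      simp [gMat, invNumer, hi]
      ring
    · intro h hh
      have hh : h ≠ 0 := by simpa using hh
      simp only [gMat, invNumer, Matrix.of_apply, if_neg hh, if_neg hi, if_pos, eq_comm (a := i) (b := h)]
      split_ifs with e
      · subst e; ring
      · ring
  · rw [Finset.sum_congr rfl (g := fun h => -(p i t * p j t * eqB p t) * p h t ^ 2 +
      (if h = j then p i t * p j t * (eqN p t * eqB p t + eqA p w t α ^ 2) else 0) +
      if h = i then invNumer p w t α i j else 0)]
    · rw [Finset.sum_add_distrib, Finset.sum_add_distrib, ← Finset.mul_sum, hN,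
        Finset.sum_ite_eq', Finset.sum_ite_eq', invNumer_apply_of_ne_zero hi hj]
      simp [gMat, invNumer, hi, hj]
      ring
    · intro h hh
      have hh : h ≠ 0 := by simpa using hh
      rw [invNumer_apply_of_ne_zero hh hj, invNumer_apply_of_ne_zero hi hj]
      simp only [gMat, Matrix.of_apply, if_neg hh, if_neg hi, eq_comm (a := i) (b := h)]
      by_cases e : h = i
      · subst e
        simp only [if_pos]
        split_ifs with e'
        · subst e'; ring
        · ring
      · rw [if_neg e, if_neg e]
        split_ifs with e'
        · subst e'; ring
        · ring

lemma gMat_inv {t : ℝ} (hreg : 0 < eqB p t ∨ deriv w t ≠ 0) (α : Fin L → ℝ) :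
    (gMat p w t α)⁻¹ = (eqN p t * eqB p t + eqA p w t α ^ 2)⁻¹ • invNumer p w t α := by
  apply Matrix.inv_eq_right_inv
  rw [Matrix.mul_smul, gMat_mul_invNumer, smul_smul,
    inv_mul_cancel₀ (eqN_mul_eqB_add_sq_pos hreg α).ne', one_smul]

lemma sum_gMat_inv_mul_zero {t : ℝ} (hreg : 0 < eqB p t ∨ deriv w t ≠ 0) (α : Fin L → ℝ)
    {c : Fin L → ℝ} {x : ℝ} (hc : ∀ h ≠ 0, c h = p h t * x) :
    ∑ h, (gMat p w t α)⁻¹ h 0 * c h =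
      (eqN p t * c 0 + eqA p w t α * x * (eqN p t - 1)) /
        (eqN p t * eqB p t + eqA p w t α ^ 2) := by
  rw [gMat_inv hreg, sum_univ_eq_zero_add, Finset.sum_congr rfl (g := fun h =>
    ((eqN p t * eqB p t + eqA p w t α ^ 2)⁻¹ * (eqA p w t α * x)) * p h t ^ 2)]
  · rw [← Finset.mul_sum, show ∑ h ∈ Finset.univ \ {0}, p h t ^ 2 = eqN p t - 1 by rw [eqN]; ring]
    simp [invNumer]
    ring
  · intro h hh
    have hh : h ≠ 0 := by simpa using hh
    simp [invNumer, hc h hh, hh]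
    ring

lemma sum_gMat_inv_mul {t : ℝ} (hreg : 0 < eqB p t ∨ deriv w t ≠ 0) (α : Fin L → ℝ)
    {k : Fin L} (hk : k ≠ 0) {c : Fin L → ℝ} {x : ℝ} (hc : ∀ h ≠ 0, c h = p h t * x) :
    ∑ h, (gMat p w t α)⁻¹ h k * c h =
      p k t * (eqA p w t α * c 0 + (eqB p t + eqA p w t α ^ 2) * x) /
        (eqN p t * eqB p t + eqA p w t α ^ 2) := by
  rw [gMat_inv hreg, sum_univ_eq_zero_add, Finset.sum_congr rfl (g := fun h =>
    (if h = k then p k t * x * ((eqN p t * eqB p t + eqA p w t α ^ 2)⁻¹ *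
      (eqN p t * eqB p t + eqA p w t α ^ 2)) else 0) -
    ((eqN p t * eqB p t + eqA p w t α ^ 2)⁻¹ * (p k t * eqB p t * x)) * p h t ^ 2)]
  · rw [Finset.sum_sub_distrib, ← Finset.mul_sum, Finset.sum_ite_eq',
      show ∑ h ∈ Finset.univ \ {0}, p h t ^ 2 = eqN p t - 1 by rw [eqN]; ring]
    simp [invNumer, hk]
    ring
  · intro h hh
    have hh : h ≠ 0 := by simpa using hh
    rw [Matrix.smul_apply, invNumer_apply_of_ne_zero hh hk, hc h hh, smul_eq_mul]
    split_ifs with e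
    · subst e; ring
    · ring

lemma hasDerivAt_of_contDiff {f : ℝ → ℝ} (hf : ContDiff ℝ (⊤ : ℕ∞) f) (t : ℝ) :
    HasDerivAt f (deriv f t) t :=
  (hf.differentiable (by simp) t).hasDerivAt

lemma hasDerivAt_deriv_of_contDiff {f : ℝ → ℝ} (hf : ContDiff ℝ (⊤ : ℕ∞) f) (t : ℝ) :
    HasDerivAt (deriv f) (deriv (deriv f) t) t :=
  hasDerivAt_of_contDiff (contDiff_infty_iff_deriv.1 hf).2 t

lemma hasDerivAt_eqA (hp : ∀ i, ContDiff ℝ (⊤ : ℕ∞) (p i)) (hw : ContDiff ℝ (⊤ : ℕ∞) w)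
    (t : ℝ) (α : Fin L → ℝ) : HasDerivAt (fun s => eqA p w s α) (eqA' p w t α) t :=
  (hasDerivAt_deriv_of_contDiff hw t).sub <| HasDerivAt.fun_sum fun m _ =>
    (hasDerivAt_deriv_of_contDiff (hp m) t).mul_const (α m)

lemma hasDerivAt_eqB (hp : ∀ i, ContDiff ℝ (⊤ : ℕ∞) (p i)) (t : ℝ) :
    HasDerivAt (eqB p) (2 * eqC p t) t := by
  rw [eqC, Finset.mul_sum]
  refine HasDerivAt.fun_sum fun m _ => ?_
  refine ((hasDerivAt_deriv_of_contDiff (hp m) t).fun_pow 2).congr_deriv ?_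
  push_cast
  ring

lemma hasDerivAt_eqN (hp : ∀ i, ContDiff ℝ (⊤ : ℕ∞) (p i)) (t : ℝ) :
    HasDerivAt (eqN p) (2 * eqP p t) t := by
  rw [eqP, Finset.mul_sum]
  refine HasDerivAt.const_add 1 (HasDerivAt.fun_sum fun m _ => ?_)
  refine ((hasDerivAt_of_contDiff (hp m) t).fun_pow 2).congr_deriv ?_
  push_cast
  ring

lemma hasDerivAt_sum_update (c α : Fin L → ℝ) {i : Fin L} (hi : i ≠ 0) (x : ℝ) :
    HasDerivAt (fun s => ∑ m ∈ Finset.univ \ {0}, c m * Function.update α i s m) (c i) x := by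
  have key : HasDerivAt (fun s => ∑ m ∈ Finset.univ \ {0}, c m * Function.update α i s m)
      (∑ m ∈ Finset.univ \ {0}, c m * (Pi.single i 1 : Fin L → ℝ) m) x :=
    HasDerivAt.fun_sum fun m _ => (hasDerivAt_pi.1 (hasDerivAt_update α i x) m).const_mul (c m)
  simpa [Pi.single_apply, hi] using key

lemma hasDerivAt_eqA_update (t : ℝ) (α : Fin L → ℝ) {i : Fin L} (hi : i ≠ 0) (x : ℝ) :
    HasDerivAt (fun s => eqA p w t (Function.update α i s)) (-deriv (p i) t) x :=
  (hasDerivAt_sum_update (fun m => deriv (p m) t) α hi x).const_sub _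

lemma hasDerivAt_eqA'_update (t : ℝ) (α : Fin L → ℝ) {i : Fin L} (hi : i ≠ 0) (x : ℝ) :
    HasDerivAt (fun s => eqA' p w t (Function.update α i s)) (-deriv (deriv (p i)) t) x :=
  (hasDerivAt_sum_update (fun m => deriv (deriv (p m)) t) α hi x).const_sub _

lemma pder_zero (f : ℝ → (Fin L → ℝ) → ℝ) (t : ℝ) (α : Fin L → ℝ) :
    pder 0 f t α = deriv (fun s => f s α) t := if_pos rfl

lemma pder_of_ne_zero {k : Fin L} (hk : k ≠ 0) (f : ℝ → (Fin L → ℝ) → ℝ) (t : ℝ)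
    (α : Fin L → ℝ) :
    pder k f t α = deriv (fun s => f t (Function.update α k s)) (α k) := if_neg hk

lemma pder_zero_gMat_zero_zero (hp : ∀ i, ContDiff ℝ (⊤ : ℕ∞) (p i))
    (hw : ContDiff ℝ (⊤ : ℕ∞) w) (t : ℝ) (α : Fin L → ℝ) :
    pder 0 (fun t' α' => gMat p w t' α' 0 0) t α =
      2 * eqC p t + 2 * eqA p w t α * eqA' p w t α := by
  simp only [pder_zero, gMat, Matrix.of_apply, if_pos]
  convert ((hasDerivAt_eqB hp t).fun_add ((hasDerivAt_eqA hp hw t α).fun_pow 2)).deriv using 1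
  push_cast
  ring

lemma pder_zero_gMat_zero (hp : ∀ i, ContDiff ℝ (⊤ : ℕ∞) (p i))
    (hw : ContDiff ℝ (⊤ : ℕ∞) w) {j : Fin L} (hj : j ≠ 0) (t : ℝ) (α : Fin L → ℝ) :
    pder 0 (fun t' α' => gMat p w t' α' 0 j) t α =
      -(deriv (p j) t * eqA p w t α) - p j t * eqA' p w t α := by
  simp only [pder_zero, gMat, Matrix.of_apply, if_pos, if_neg hj]
  convert ((hasDerivAt_of_contDiff (hp j) t).fun_neg.fun_mul (hasDerivAt_eqA hp hw t α)).deriv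
    using 1
  ring

lemma pder_zero_gMat (hp : ∀ i, ContDiff ℝ (⊤ : ℕ∞) (p i)) {i j : Fin L} (hi : i ≠ 0)
    (hj : j ≠ 0) (t : ℝ) (α : Fin L → ℝ) :
    pder 0 (fun t' α' => gMat p w t' α' i j) t α =
      deriv (p i) t * p j t + p i t * deriv (p j) t := by
  simp only [pder_zero, gMat, Matrix.of_apply, if_neg hi, if_neg hj]
  exact (((hasDerivAt_of_contDiff (hp i) t).fun_mul
    (hasDerivAt_of_contDiff (hp j) t)).add_const _).deriv

lemma pder_gMat_zero_zero {k : Fin L} (hk : k ≠ 0) (t : ℝ) (α : Fin L → ℝ) :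
    pder k (fun t' α' => gMat p w t' α' 0 0) t α = -(2 * eqA p w t α * deriv (p k) t) := by
  simp only [pder_of_ne_zero hk, gMat, Matrix.of_apply, if_pos]
  convert (((hasDerivAt_eqA_update (p := p) (w := w) t α hk (α k)).fun_pow 2).const_add
    (eqB p t)).deriv using 1
  simp

lemma pder_gMat_zero {j k : Fin L} (hj : j ≠ 0) (hk : k ≠ 0) (t : ℝ) (α : Fin L → ℝ) :
    pder k (fun t' α' => gMat p w t' α' 0 j) t α = p j t * deriv (p k) t := by
  simp only [pder_of_ne_zero hk, gMat, Matrix.of_apply, if_pos, if_neg hj]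
  convert ((hasDerivAt_eqA_update (p := p) (w := w) t α hk (α k)).const_mul (-p j t)).deriv using 1
  ring

lemma pder_gMat {i j k : Fin L} (hi : i ≠ 0) (hj : j ≠ 0) (hk : k ≠ 0) (t : ℝ)
    (α : Fin L → ℝ) : pder k (fun t' α' => gMat p w t' α' i j) t α = 0 := by
  simp only [pder_of_ne_zero hk, gMat, Matrix.of_apply, if_neg hi, if_neg hj, deriv_const]

lemma christoffel_zero_zero_zero (hp : ∀ i, ContDiff ℝ (⊤ : ℕ∞) (p i))
    (hw : ContDiff ℝ (⊤ : ℕ∞) w) {t : ℝ} (hreg : 0 < eqB p t ∨ deriv w t ≠ 0)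
    (α : Fin L → ℝ) :
    christoffel p w 0 0 0 t α =
      (eqN p t * eqC p t + eqA p w t α * eqA' p w t α) /
        (eqN p t * eqB p t + eqA p w t α ^ 2) := by
  rw [christoffel, sum_gMat_inv_mul_zero hreg α (x := -2 * eqA' p w t α)]
  · rw [pder_zero_gMat_zero_zero hp hw]
    ring
  · intro h hh
    simp only [gMat_comm _ _ h]
    rw [pder_zero_gMat_zero hp hw hh, pder_gMat_zero_zero hh]
    ring

lemma christoffel_zero_zero (hp : ∀ i, ContDiff ℝ (⊤ : ℕ∞) (p i))
    (hw : ContDiff ℝ (⊤ : ℕ∞) w) {t : ℝ} (hreg : 0 < eqB p t ∨ deriv w t ≠ 0)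
    (α : Fin L → ℝ) {k : Fin L} (hk : k ≠ 0) :
    christoffel p w 0 0 k t α =
      p k t * (eqA p w t α * eqC p t - eqB p t * eqA' p w t α) /
        (eqN p t * eqB p t + eqA p w t α ^ 2) := by
  rw [christoffel, sum_gMat_inv_mul hreg α hk (x := -2 * eqA' p w t α)]
  · rw [pder_zero_gMat_zero_zero hp hw]
    ring
  · intro h hh
    simp only [gMat_comm _ _ h]
    rw [pder_zero_gMat_zero hp hw hh, pder_gMat_zero_zero hh]
    ring

lemma christoffel_zero_left_zero (hp : ∀ i, ContDiff ℝ (⊤ : ℕ∞) (p i)) {t : ℝ}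
    (hreg : 0 < eqB p t ∨ deriv w t ≠ 0) (α : Fin L → ℝ) {i : Fin L} (hi : i ≠ 0) :
    christoffel p w 0 i 0 t α =
      -(deriv (p i) t * eqA p w t α) / (eqN p t * eqB p t + eqA p w t α ^ 2) := by
  rw [christoffel, sum_gMat_inv_mul_zero hreg α (x := 2 * deriv (p i) t)]
  · simp only [gMat_comm _ _ i]
    rw [pder_gMat_zero_zero hi]
    ring
  · intro h hh
    simp only [gMat_comm _ _ h 0]
    rw [pder_zero_gMat hp hi hh, pder_gMat_zero hh hi, pder_gMat_zero hi hh]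
    ring

lemma christoffel_zero_left (hp : ∀ i, ContDiff ℝ (⊤ : ℕ∞) (p i)) {t : ℝ}
    (hreg : 0 < eqB p t ∨ deriv w t ≠ 0) (α : Fin L → ℝ) {i k : Fin L} (hi : i ≠ 0)
    (hk : k ≠ 0) :
    christoffel p w 0 i k t α =
      deriv (p i) t * p k t * eqB p t / (eqN p t * eqB p t + eqA p w t α ^ 2) := by
  rw [christoffel, sum_gMat_inv_mul hreg α hk (x := 2 * deriv (p i) t)]
  · simp only [gMat_comm _ _ i]
    rw [pder_gMat_zero_zero hi]
    ring
  · intro h hh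
    simp only [gMat_comm _ _ h 0]
    rw [pder_zero_gMat hp hi hh, pder_gMat_zero hh hi, pder_gMat_zero hi hh]
    ring

lemma christoffel_eq_zero (hp : ∀ i, ContDiff ℝ (⊤ : ℕ∞) (p i)) {t : ℝ}
    (hreg : 0 < eqB p t ∨ deriv w t ≠ 0) (α : Fin L → ℝ) {i j k : Fin L} (hi : i ≠ 0)
    (hj : j ≠ 0) (hk : k ≠ 0) : christoffel p w i j k t α = 0 := by
  rw [christoffel, sum_gMat_inv_mul hreg α hk (x := 0)]
  · simp only [gMat_comm _ _ j 0]
    rw [pder_gMat_zero hj hi, pder_gMat_zero hi hj, pder_zero_gMat hp hi hj]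
    ring
  · intro h hh
    rw [pder_gMat hj hh hi, pder_gMat hh hi hj, pder_gMat hi hj hh]
    ring

lemma pder_christoffel_zero_zero (hp : ∀ i, ContDiff ℝ (⊤ : ℕ∞) (p i))
    (hw : ContDiff ℝ (⊤ : ℕ∞) w) {t : ℝ} (hreg : 0 < eqB p t ∨ deriv w t ≠ 0)
    (α : Fin L → ℝ) {i k : Fin L} (hi : i ≠ 0) (hk : k ≠ 0) :
    pder i (christoffel p w 0 0 k) t α =
      (p k t * (-(deriv (p i) t * eqC p t) + eqB p t * deriv (deriv (p i)) t) *
          (eqN p t * eqB p t + eqA p w t α ^ 2) +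
        p k t * (eqA p w t α * eqC p t - eqB p t * eqA' p w t α) *
          (2 * eqA p w t α * deriv (p i) t)) /
        (eqN p t * eqB p t + eqA p w t α ^ 2) ^ 2 := by
  simp only [pder_of_ne_zero hi, christoffel_zero_zero hp hw hreg _ hk]
  have hA := hasDerivAt_eqA_update (p := p) (w := w) t α hi (α i)
  have hA' := hasDerivAt_eqA'_update (p := p) (w := w) t α hi (α i)
  have hD := (eqN_mul_eqB_add_sq_pos hreg (Function.update α i (α i))).ne'
  have key := ((((hA.mul_const (eqC p t)).fun_sub (hA'.const_mul (eqB p t))).const_mul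
    (p k t)).fun_div ((hA.fun_pow 2).const_add (eqN p t * eqB p t)) hD).deriv
  rw [key]
  simp only [Function.update_eq_self]
  push_cast
  ring

lemma pder_zero_christoffel (hp : ∀ i, ContDiff ℝ (⊤ : ℕ∞) (p i))
    (hw : ContDiff ℝ (⊤ : ℕ∞) w) (hreg : ∀ t, 0 < eqB p t ∨ deriv w t ≠ 0) (t : ℝ)
    (α : Fin L → ℝ) {i k : Fin L} (hi : i ≠ 0) (hk : k ≠ 0) :
    pder 0 (christoffel p w i 0 k) t α =
      ((deriv (deriv (p i)) t * p k t * eqB p t + deriv (p i) t * deriv (p k) t * eqB p t +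
            2 * deriv (p i) t * p k t * eqC p t) *
          (eqN p t * eqB p t + eqA p w t α ^ 2) -
        deriv (p i) t * p k t * eqB p t *
          (2 * eqP p t * eqB p t + 2 * eqN p t * eqC p t +
            2 * eqA p w t α * eqA' p w t α)) /
        (eqN p t * eqB p t + eqA p w t α ^ 2) ^ 2 := by
  simp only [pder_zero, christoffel_comm i 0, christoffel_zero_left hp (hreg _) _ hi hk]
  have key := ((((hasDerivAt_deriv_of_contDiff (hp i) t).fun_mul
    (hasDerivAt_of_contDiff (hp k) t)).fun_mul (hasDerivAt_eqB hp t)).fun_div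
    (((hasDerivAt_eqN hp t).fun_mul (hasDerivAt_eqB hp t)).fun_add
      ((hasDerivAt_eqA hp hw t α).fun_pow 2))
    (eqN_mul_eqB_add_sq_pos (hreg t) α).ne').deriv
  rw [key]
  push_cast
  ring

end Curvature

theorem statement_14 (L : ℕ) [NeZero L] (hL : 2 ≤ L)
    (p : Fin L → ℝ → ℝ) (w : ℝ → ℝ)
    (hp : ∀ i, ContDiff ℝ (⊤ : ℕ∞) (p i)) (hw : ContDiff ℝ (⊤ : ℕ∞) w)
    (hreg : ∀ t : ℝ, 0 < eqB p t ∨ deriv w t ≠ 0) :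
    ∀ i k : Fin L, i ≠ 0 → k ≠ 0 →
      ∀ (t : ℝ) (α : Fin L → ℝ),
        curvR p w 0 i 0 k t α
          = (deriv (p i) t * p k t * (eqB p t) ^ 2 * eqP p t
              - deriv (p i) t * deriv (p k) t * eqB p t * (eqN p t * eqB p t + (eqA p w t α) ^ 2))
            / (eqN p t * eqB p t + (eqA p w t α) ^ 2) ^ 2 := by
  intro i k hi hk t α
  have hD := (eqN_mul_eqB_add_sq_pos (hreg t) α).ne'
  have hleft : ∑ m ∈ Finset.univ \ {0},
      christoffel p w 0 0 m t α * christoffel p w i m k t α = 0 := by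
    refine Finset.sum_eq_zero fun m hm => ?_
    rw [christoffel_eq_zero hp (hreg t) α hi (by simpa using hm) hk, mul_zero]
  have hright : ∑ m ∈ Finset.univ \ {0},
      christoffel p w i 0 m t α * christoffel p w 0 m k t α =
        deriv (p i) t * p k t * eqB p t ^ 2 * eqP p t /
          (eqN p t * eqB p t + eqA p w t α ^ 2) ^ 2 := by
    rw [eqP, Finset.mul_sum, Finset.sum_div]
    refine Finset.sum_congr rfl fun m hm => ?_
    have hm : m ≠ 0 := by simpa using hm
    rw [christoffel_comm i, christoffel_zero_left hp (hreg t) α hi hm,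
      christoffel_zero_left hp (hreg t) α hm hk]
    field_simp
  rw [curvR, sum_univ_eq_zero_add, sum_univ_eq_zero_add, hleft, hright,
    pder_christoffel_zero_zero hp hw (hreg t) α hi hk, pder_zero_christoffel hp hw hreg t α hi hk,
    christoffel_comm i 0, christoffel_comm i 0, christoffel_zero_zero_zero hp hw (hreg t),
    christoffel_zero_left hp (hreg t) α hi hk, christoffel_zero_left_zero hp (hreg t) α hi,
    christoffel_zero_zero hp hw (hreg t) α hk]
  field_simp
  ring

end EqSelection
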